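/- arXiv:2007.06264 — 2 statements merged into one kernel-verified Lean document; each statement's English description precedes it below -/
import Mathlib

section
/- Let q, t ∈ (0,1), τ := log_q t, ζ₊ > 0, ζ₋ < 0, N ∈ ℤ_{≥1}. Fix c = conj(d) ∈ ℂ∖ℝ with R := |c|, and radii R₁, R₂ > 0 with R₁R₂ < R² · q^{2τ(N−1)+1}. Then the convergence of Σ_{X∈Ω_N} |M̃_N(X; q,t; a,b,c,d)| is uniform on the bidisc {|a| ≤ R₁, |b| ≤ R₂}: for every ε > 0 there exists a finite subset F ⊂ Ω_N such that Σ_{X∈Ω_N∖F} |M̃_N(X; q,t; a,b,c,d)| < ε simultaneously for all complex a, b with |a| ≤ R₁ and |b| ≤ R₂. -/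
/-- The infinite q-Pochhammer symbol `(u; q)_∞` (complex version). -/
noncomputable def qPochC (q : ℝ) (u : ℂ) : ℂ := ∏' n : ℕ, (1 - u * (q : ℂ) ^ n)

/-- The infinite q-Pochhammer symbol `(u; q)_∞` (real version). -/
noncomputable def qPochR (q u : ℝ) : ℝ := ∏' n : ℕ, (1 - u * q ^ n)

/-- The weight function `W(x; q; a,b,c,d) = (1-q)|x| (ax;q)_∞(bx;q)_∞ / ((cx;q)_∞(dx;q)_∞)`. -/
noncomputable def Wc (q : ℝ) (a b c d : ℂ) (x : ℝ) : ℂ :=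
  (((1 - q) * |x| : ℝ) : ℂ) * (qPochC q (a * x) * qPochC q (b * x)) /
    (qPochC q (c * x) * qPochC q (d * x))

/-- The theta function `θ_q(v) = (v;q)_∞ (q v⁻¹;q)_∞`. -/
noncomputable def thetaQ (q v : ℝ) : ℝ := qPochR q v * qPochR q (q * v⁻¹)

/-- `ψ_τ(u) = (-u)^{2τ-1} θ_q(tu)/θ_q(t u⁻¹)` with `τ = log_q t`. -/
noncomputable def psiQ (q t u : ℝ) : ℝ :=
  (-u) ^ (2 * Real.logb q t - 1) * thetaQ q (t * u) / thetaQ q (t * u⁻¹)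

/-- A (finite or countably infinite) particle configuration: a countable set of nonzero
reals, whose points can be enumerated from the outside toward 0 on each side, whose
outermost positive (resp. negative) point lies on `ζ₊ q^ℤ` (resp. `ζ₋ q^ℤ`), and in which
any two consecutive points of the same sign have ratio in `t q^{ℤ≥0}`. -/
def IsConfig (q t ζp ζm : ℝ) (X : Set ℝ) : Prop :=
  X.Countable ∧ (0 : ℝ) ∉ X ∧
  (∀ x ∈ X, 0 < x → {y ∈ X | x < y}.Finite) ∧
  (∀ x ∈ X, x < 0 → {y ∈ X | y < x}.Finite) ∧
  (∀ x ∈ X, 0 < x → (∀ y ∈ X, 0 < y → y ≤ x) → ∃ n : ℤ, x = ζp * q ^ n) ∧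
  (∀ x ∈ X, x < 0 → (∀ y ∈ X, y < 0 → x ≤ y) → ∃ n : ℤ, x = ζm * q ^ n) ∧
  (∀ x ∈ X, ∀ y ∈ X, 0 < y → y < x → (∀ z ∈ X, z ≤ y ∨ x ≤ z) → ∃ k : ℕ, y = x * t * q ^ k) ∧
  (∀ x ∈ X, ∀ y ∈ X, y < x → x < 0 → (∀ z ∈ X, z ≤ y ∨ x ≤ z) → ∃ k : ℕ, x = y * t * q ^ k)

/-- The set `Ω_N` of N-particle configurations, realized as finsets of reals. -/
def OmegaN (q t ζp ζm : ℝ) (N : ℕ) : Set (Finset ℝ) :=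
  {X | X.card = N ∧ IsConfig q t ζp ζm ↑X}

/-- The (q,t)-interaction `V_{q,t}(X)`. -/
noncomputable def Vqt (q t : ℝ) (X : Finset ℝ) : ℝ :=
  (∏ x ∈ X, ∏ y ∈ X, if y < x then (x - y) else 1) *
  (∏ x ∈ X, ∏ y ∈ X, if 0 < x ∧ y < x then
      x ^ (2 * Real.logb q t - 1) * qPochR q (q * t⁻¹ * y * x⁻¹) / qPochR q (t * y * x⁻¹)
    else 1) *
  (∏ x ∈ X, ∏ y ∈ X, if x < 0 ∧ y < x then
      |y| ^ (2 * Real.logb q t - 1) * qPochR q (q * t⁻¹ * x * y⁻¹) / qPochR q (t * x * y⁻¹)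
    else 1)

/-- The constant `C_N(k) = ∏_{1≤i<j≤N, i≤k} ψ_τ(ζ₋ζ₊⁻¹ t^{N-i-j+1})`. -/
noncomputable def CNconst (q t ζp ζm : ℝ) (N k : ℕ) : ℝ :=
  ∏ i ∈ Finset.Icc 1 N, ∏ j ∈ Finset.Icc 1 N,
    if i < j ∧ i ≤ k then psiQ q t (ζm * ζp⁻¹ * t ^ ((N : ℤ) - (i : ℤ) - (j : ℤ) + 1)) else 1

/-- The unnormalized N-particle weight
`M̃_N(X) = C_N(|X⁺|) V_{q,t}(X) ∏_{x∈X} W(x; q; a,b,c,d)`. -/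
noncomputable def Mtilde (q t ζp ζm : ℝ) (N : ℕ) (a b c d : ℂ) (X : Finset ℝ) : ℂ :=
  ((CNconst q t ζp ζm N (X.filter (fun x => 0 < x)).card * Vqt q t X : ℝ) : ℂ) *
    ∏ x ∈ X, Wc q a b c d x

open Filter Topology

section QPochhammer

variable {q : ℝ}

lemma summable_norm_mul_pow {𝕜 : Type*} [NormedField 𝕜] {r : 𝕜} (hr : ‖r‖ < 1) (u : 𝕜) :
    Summable fun n : ℕ => ‖-(u * r ^ n)‖ := by
  simp only [norm_neg, norm_mul, norm_pow]
  exact (summable_geometric_of_lt_one (norm_nonneg _) hr).mul_left _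

lemma multipliable_one_sub_mul_pow {𝕜 : Type*} [NormedField 𝕜] [CompleteSpace 𝕜] {r : 𝕜}
    (hr : ‖r‖ < 1) (u : 𝕜) : Multipliable fun n : ℕ => 1 - u * r ^ n := by
  simpa only [sub_eq_add_neg] using multipliable_one_add_of_summable (summable_norm_mul_pow hr u)

lemma tprod_one_sub_mul_pow_succ {𝕜 : Type*} [NormedField 𝕜] [CompleteSpace 𝕜] {r : 𝕜}
    (hr : ‖r‖ < 1) (u : 𝕜) :
    ∏' n : ℕ, (1 - u * r ^ n) = (1 - u) * ∏' n : ℕ, (1 - u * r * r ^ n) := by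
  have h := multipliable_one_sub_mul_pow hr (u * r)
  rw [tprod_eq_zero_mul' (f := fun n : ℕ => 1 - u * r ^ n)]
  · simp only [pow_zero, mul_one, pow_succ', mul_assoc]
  · simpa only [pow_succ', mul_assoc] using h

lemma norm_ofReal_lt_one (hq0 : 0 < q) (hq1 : q < 1) : ‖(q : ℂ)‖ < 1 := by
  rwa [Complex.norm_real, Real.norm_of_nonneg hq0.le]

lemma norm_lt_one_of_pos (hq0 : 0 < q) (hq1 : q < 1) : ‖q‖ < 1 := by
  rwa [Real.norm_of_nonneg hq0.le]

lemma tendsto_qPochR (hq0 : 0 < q) (hq1 : q < 1) (u : ℝ) :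
    Tendsto (fun n => ∏ i ∈ Finset.range n, (1 - u * q ^ i)) atTop (𝓝 (qPochR q u)) :=
  (multipliable_one_sub_mul_pow (norm_lt_one_of_pos hq0 hq1) u).hasProd.tendsto_prod_nat

lemma tendsto_qPochC (hq0 : 0 < q) (hq1 : q < 1) (u : ℂ) :
    Tendsto (fun n => ∏ i ∈ Finset.range n, (1 - u * (q : ℂ) ^ i)) atTop (𝓝 (qPochC q u)) :=
  (multipliable_one_sub_mul_pow (norm_ofReal_lt_one hq0 hq1) u).hasProd.tendsto_prod_nat

lemma qPochR_succ (hq0 : 0 < q) (hq1 : q < 1) (u : ℝ) :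
    qPochR q u = (1 - u) * qPochR q (u * q) :=
  tprod_one_sub_mul_pow_succ (norm_lt_one_of_pos hq0 hq1) u

lemma qPochC_succ (hq0 : 0 < q) (hq1 : q < 1) (u : ℂ) :
    qPochC q u = (1 - u) * qPochC q (u * q) :=
  tprod_one_sub_mul_pow_succ (norm_ofReal_lt_one hq0 hq1) u

lemma qPochR_eq_prod_mul (hq0 : 0 < q) (hq1 : q < 1) (u : ℝ) (n : ℕ) :
    qPochR q u = (∏ i ∈ Finset.range n, (1 - u * q ^ i)) * qPochR q (u * q ^ n) := by
  induction n with
  | zero => simp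
  | succ n ih =>
    rw [ih, Finset.prod_range_succ, qPochR_succ hq0 hq1 (u * q ^ n), pow_succ]
    simp only [mul_assoc]

lemma norm_qPochC_le (hq0 : 0 < q) (hq1 : q < 1) {u : ℂ} {v : ℝ} (h : ‖u‖ ≤ v) :
    ‖qPochC q u‖ ≤ qPochR q (-v) := by
  refine le_of_tendsto_of_tendsto' (tendsto_qPochC hq0 hq1 u).norm (tendsto_qPochR hq0 hq1 _)
    fun n => ?_
  rw [norm_prod]
  refine Finset.prod_le_prod (fun i _ => norm_nonneg _) fun i _ => ?_
  refine (norm_sub_le _ _).trans ?_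
  have : ‖u‖ * q ^ i ≤ v * q ^ i := by gcongr
  simpa [abs_of_pos hq0] using this

lemma abs_qPochR_le (hq0 : 0 < q) (hq1 : q < 1) {u v : ℝ} (h : |u| ≤ v) :
    |qPochR q u| ≤ qPochR q (-v) := by
  refine le_of_tendsto_of_tendsto' (tendsto_qPochR hq0 hq1 u).abs (tendsto_qPochR hq0 hq1 _)
    fun n => ?_
  rw [Finset.abs_prod]
  refine Finset.prod_le_prod (fun i _ => abs_nonneg _) fun i _ => ?_
  refine (abs_sub _ _).trans ?_
  have : |u| * q ^ i ≤ v * q ^ i := by gcongr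
  simpa [abs_mul, abs_of_pos hq0] using this

lemma qPochR_neg_mono (hq0 : 0 < q) (hq1 : q < 1) {u v : ℝ} (hu : 0 ≤ u) (h : u ≤ v) :
    qPochR q (-u) ≤ qPochR q (-v) :=
  (le_abs_self _).trans (abs_qPochR_le hq0 hq1 (by rwa [abs_neg, abs_of_nonneg hu]))

lemma one_le_qPochR_neg (hq0 : 0 < q) (hq1 : q < 1) {u : ℝ} (hu : 0 ≤ u) :
    1 ≤ qPochR q (-u) := by
  simpa [qPochR] using qPochR_neg_mono hq0 hq1 le_rfl hu

lemma prod_le_qPochR_neg (hq0 : 0 < q) (hq1 : q < 1) {u : ℝ} (hu : 0 ≤ u) (n : ℕ) :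
    ∏ i ∈ Finset.range n, (1 + u * q ^ i) ≤ qPochR q (-u) := by
  rw [qPochR_eq_prod_mul hq0 hq1 (-u) n]
  simp only [neg_mul, sub_neg_eq_add]
  exact le_mul_of_one_le_right (Finset.prod_nonneg fun i _ => by positivity)
    (one_le_qPochR_neg hq0 hq1 (by positivity))

lemma qPochR_anti (hq0 : 0 < q) (hq1 : q < 1) {u v : ℝ} (h : u ≤ v) (hv : v ≤ 1) :
    qPochR q v ≤ qPochR q u := by
  refine le_of_tendsto_of_tendsto' (tendsto_qPochR hq0 hq1 v) (tendsto_qPochR hq0 hq1 u)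
    fun n => ?_
  refine Finset.prod_le_prod (fun i _ => ?_) fun i _ => by gcongr
  have h1 : q ^ i ≤ 1 := pow_le_one₀ hq0.le hq1.le
  have h2 : 0 < q ^ i := by positivity
  nlinarith

lemma qPochR_pos (hq0 : 0 < q) (hq1 : q < 1) {u : ℝ} (hu : u < 1) :
    0 < qPochR q u := by
  have hfac : ∀ i : ℕ, 0 < 1 - u * q ^ i := fun i => by
    have h1 : q ^ i ≤ 1 := pow_le_one₀ hq0.le hq1.le
    have h2 : 0 < q ^ i := by positivity
    nlinarith
  refine lt_of_le_of_ne (ge_of_tendsto' (tendsto_qPochR hq0 hq1 u) fun n =>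
    Finset.prod_nonneg fun i _ => (hfac i).le) (Ne.symm ?_)
  have := tprod_one_add_ne_zero_of_summable (f := fun i : ℕ => -(u * q ^ i))
    (fun i => by simpa only [← sub_eq_add_neg] using (hfac i).ne')
    (summable_norm_mul_pow (norm_lt_one_of_pos hq0 hq1) u)
  simpa only [← sub_eq_add_neg, qPochR] using this

lemma qPochC_ne_zero (hq0 : 0 < q) (hq1 : q < 1) {c : ℂ} (hc : c.im ≠ 0) (x : ℝ) :
    qPochC q (c * x) ≠ 0 := by
  have hfac : ∀ i : ℕ, 1 - c * x * (q : ℂ) ^ i ≠ 0 := fun i h => by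
    have h1 := congrArg Complex.im h
    have h2 := congrArg Complex.re h
    have h3 : c * x * (q : ℂ) ^ i = c * ((x * q ^ i : ℝ) : ℂ) := by push_cast; ring
    rw [h3, Complex.sub_im, Complex.im_mul_ofReal] at h1
    rw [h3, Complex.sub_re, Complex.re_mul_ofReal] at h2
    have : x * q ^ i = 0 := by simpa [hc] using h1
    simp [this] at h2
  have := tprod_one_add_ne_zero_of_summable (f := fun i : ℕ => -(c * x * (q : ℂ) ^ i))
    (fun i => by simpa only [← sub_eq_add_neg] using hfac i)
    (summable_norm_mul_pow (norm_ofReal_lt_one hq0 hq1) _)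
  simpa only [← sub_eq_add_neg, qPochC] using this

/-- Splitting off the first `n` factors, the quotient `(-Av;q)_∞ / (-Bv;q)_∞` grows at most like
`(A/B)^n` at `v ≈ q⁻ⁿ`. -/
lemma qPochR_neg_le_mul_pow (hq0 : 0 < q) (hq1 : q < 1) {A B : ℝ} (hA : 0 < A) (hB : 0 < B)
    {v : ℝ} {n : ℕ} (h1 : 1 ≤ v * q ^ n) (h2 : v * q ^ n ≤ q⁻¹) :
    qPochR q (-(A * v)) ≤
      qPochR q (-(A * q⁻¹)) * qPochR q (-A⁻¹) * (A / B) ^ n * qPochR q (-(B * v)) := by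
  have hv : 0 < v := pos_of_mul_pos_left (zero_lt_one.trans_le h1) (by positivity)
  have key : ∏ i ∈ Finset.range n, (1 + A * v * q ^ i) ≤
      (A / B) ^ n * (∏ i ∈ Finset.range n, (1 + A⁻¹ * q ^ i)) *
        ∏ i ∈ Finset.range n, (1 + B * v * q ^ i) := by
    have hpow : (A / B) ^ n = ∏ _i ∈ Finset.range n, A / B := by
      rw [Finset.prod_const, Finset.card_range]
    rw [← Finset.prod_range_reflect (fun i => 1 + A⁻¹ * q ^ i) n, hpow,
      ← Finset.prod_mul_distrib, ← Finset.prod_mul_distrib]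
    refine Finset.prod_le_prod (fun i _ => by positivity) fun i hi => ?_
    have hi' := Finset.mem_range.mp hi
    have hsplit : q ^ n = q ^ i * q * q ^ (n - 1 - i) := by
      rw [← pow_succ, ← pow_add]; congr 1; omega
    have h3 : 1 ≤ v * q ^ i * q ^ (n - 1 - i) := by
      rw [hsplit] at h1
      have : v * (q ^ i * q * q ^ (n - 1 - i)) = q * (v * q ^ i * q ^ (n - 1 - i)) := by ring
      rw [this] at h1
      have h0 : 0 ≤ v * q ^ i * q ^ (n - 1 - i) := by positivity
      nlinarith
    have h4 : A / B * (1 + A⁻¹ * q ^ (n - 1 - i)) * (B * v * q ^ i) =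
        A * v * q ^ i + v * q ^ i * q ^ (n - 1 - i) := by field_simp
    have h5 : 0 ≤ A / B * (1 + A⁻¹ * q ^ (n - 1 - i)) := by positivity
    linarith
  have hP : qPochR q (-(A * v)) =
      (∏ i ∈ Finset.range n, (1 + A * v * q ^ i)) * qPochR q (-(A * (v * q ^ n))) := by
    rw [qPochR_eq_prod_mul hq0 hq1 _ n]
    simp only [neg_mul, sub_neg_eq_add, mul_assoc]
  have hA1 : 0 ≤ qPochR q (-A⁻¹) :=
    zero_le_one.trans (one_le_qPochR_neg hq0 hq1 (by positivity))
  have hA2 : 0 ≤ qPochR q (-(A * (v * q ^ n))) :=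
    zero_le_one.trans (one_le_qPochR_neg hq0 hq1 (by positivity))
  calc qPochR q (-(A * v))
      ≤ ((A / B) ^ n * (∏ i ∈ Finset.range n, (1 + A⁻¹ * q ^ i)) *
        ∏ i ∈ Finset.range n, (1 + B * v * q ^ i)) * qPochR q (-(A * (v * q ^ n))) := by
        rw [hP]; gcongr
    _ ≤ ((A / B) ^ n * qPochR q (-A⁻¹) * qPochR q (-(B * v))) * qPochR q (-(A * q⁻¹)) := by
        have hB1 : 0 ≤ qPochR q (-(B * v)) :=
          zero_le_one.trans (one_le_qPochR_neg hq0 hq1 (by positivity))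
        gcongr
        · exact prod_le_qPochR_neg hq0 hq1 (by positivity) n
        · exact prod_le_qPochR_neg hq0 hq1 (by positivity) n
        · exact qPochR_neg_mono hq0 hq1 (by positivity) (by gcongr)
    _ = _ := by ring

lemma rpow_le_one_add_rpow {r m : ℝ} (hm : 0 < m) (h1 : m ≤ r) (h2 : r ≤ 1) (e : ℝ) :
    r ^ e ≤ 1 + m ^ e := by
  rcases le_total 0 e with he | he
  · have := Real.rpow_le_one (hm.le.trans h1) h2 he
    have := Real.rpow_nonneg hm.le e
    linarith
  · have := Real.rpow_le_rpow_of_nonpos hm h1 he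
    linarith

lemma exists_qPochR_neg_le (hq0 : 0 < q) (hq1 : q < 1) {A B e : ℝ} (hA : 0 < A) (hB : 0 < B)
    (he : q⁻¹ ^ e = A / B) :
    ∃ C : ℝ, 0 ≤ C ∧ ∀ v : ℝ, 0 < v →
      qPochR q (-(A * v)) ≤ C * (1 + v) ^ e * qPochR q (-(B * v)) := by
  have hA1 : 1 ≤ qPochR q (-A⁻¹) := one_le_qPochR_neg hq0 hq1 (by positivity)
  have hA2 : 1 ≤ qPochR q (-(A * q⁻¹)) := one_le_qPochR_neg hq0 hq1 (by positivity)
  have hq : 1 < q⁻¹ := (one_lt_inv₀ hq0).mpr hq1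
  set M := qPochR q (-(A * q⁻¹)) * qPochR q (-A⁻¹) with hM
  have hM0 : 0 ≤ M := by positivity
  have hm : (0 : ℝ) ≤ (q / 2) ^ e := by positivity
  refine ⟨M * (1 + (q / 2) ^ e), by positivity, fun v hv => ?_⟩
  have hB1 : 1 ≤ qPochR q (-(B * v)) := one_le_qPochR_neg hq0 hq1 (by positivity)
  obtain ⟨s, hs0, hs1, hs2, hs3⟩ : ∃ s : ℝ, 0 < s ∧ s ≤ 1 + v ∧ q / 2 * (1 + v) ≤ s ∧
      qPochR q (-(A * v)) ≤ M * s ^ e * qPochR q (-(B * v)) := by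
    rcases lt_or_ge v 1 with h | h
    · refine ⟨1, one_pos, by linarith, by nlinarith, ?_⟩
      have : qPochR q (-(A * v)) ≤ qPochR q (-(A * q⁻¹)) :=
        qPochR_neg_mono hq0 hq1 (by positivity) (by gcongr; linarith)
      rw [Real.one_rpow, mul_one]
      nlinarith [mul_nonneg (sub_nonneg.2 hA1) (sub_nonneg.2 hB1), mul_le_mul hA1 hB1 zero_le_one
        (by positivity), mul_le_mul_of_nonneg_left (mul_le_mul hA1 hB1 zero_le_one
        (by positivity)) (zero_le_one.trans hA2)]
    · obtain ⟨n, hn1, hn2⟩ := exists_nat_pow_near h hq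
      have hqn : q⁻¹ ^ n * q ^ n = 1 := by rw [← mul_pow, inv_mul_cancel₀ hq0.ne', one_pow]
      have hqp : 0 < q ^ n := by positivity
      refine ⟨q⁻¹ ^ n, by positivity, by linarith, ?_, ?_⟩
      · have : q * v ≤ q⁻¹ ^ n := by
          have := mul_le_mul_of_nonneg_left hn2.le hq0.le
          rwa [pow_succ', ← mul_assoc, mul_inv_cancel₀ hq0.ne', one_mul] at this
        nlinarith
      · rw [← Real.rpow_natCast, ← Real.rpow_mul (by positivity), mul_comm (n : ℝ),
          Real.rpow_mul (by positivity), he, Real.rpow_natCast]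
        refine qPochR_neg_le_mul_pow hq0 hq1 hA hB ?_ ?_
        · rw [← hqn]; gcongr
        · have := mul_le_mul_of_nonneg_right hn2.le hqp.le
          rwa [pow_succ', mul_assoc, hqn, mul_one] at this
  refine hs3.trans ?_
  have hr := rpow_le_one_add_rpow (half_pos hq0) ((le_div_iff₀ (by linarith)).2 hs2)
    ((div_le_one (by linarith)).2 hs1) e
  rw [Real.div_rpow hs0.le (by linarith), div_le_iff₀ (Real.rpow_pos_of_pos (by linarith) _)] at hr
  calc M * s ^ e * qPochR q (-(B * v))
      ≤ M * ((1 + (q / 2) ^ e) * (1 + v) ^ e) * qPochR q (-(B * v)) := by gcongr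
    _ = _ := by ring

end QPochhammer

section Interaction

variable {q t : ℝ}

lemma prod_prod_lt_mul {α M : Type*} [LinearOrder α] [CommMonoid M] (S : Finset α) (h : α → M) :
    ∏ x ∈ S, ∏ y ∈ S, (if y < x then h x * h y else 1) = ∏ x ∈ S, h x ^ (S.card - 1) := by
  have h1 : ∀ x y : α, (if y < x then h x * h y else 1) =
      (if y < x then h x else 1) * (if y < x then h y else 1) := fun x y => by
    split_ifs <;> simp
  simp only [h1, Finset.prod_mul_distrib]
  rw [Finset.prod_comm (f := fun x y => if y < x then h y else 1), ← Finset.prod_mul_distrib]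
  refine Finset.prod_congr rfl fun x hx => ?_
  rw [← Finset.prod_mul_distrib, ← Finset.card_erase_of_mem hx, ← Finset.prod_const,
    ← Finset.mul_prod_erase S _ hx]
  simp only [lt_irrefl, if_false, one_mul]
  refine Finset.prod_congr rfl fun y hy => ?_
  rcases lt_or_gt_of_ne (Finset.ne_of_mem_erase hy) with hlt | hlt <;> simp [hlt, hlt.not_gt]

lemma abs_prod_prod_le {α : Type*} [LinearOrder α] (S : Finset α) {G : α → α → ℝ} {h : α → ℝ}
    {C : ℝ} (hC : 1 ≤ C) (hG : ∀ x y, ¬ y < x → G x y = 1)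
    (hGle : ∀ x ∈ S, ∀ y ∈ S, y < x → |G x y| ≤ C * (h x * h y)) :
    |∏ x ∈ S, ∏ y ∈ S, G x y| ≤ C ^ (S.card * S.card) * ∏ x ∈ S, h x ^ (S.card - 1) := by
  rw [← prod_prod_lt_mul, pow_mul, ← Finset.prod_const, ← Finset.prod_const,
    ← Finset.prod_mul_distrib]
  simp only [← Finset.prod_mul_distrib]
  rw [Finset.abs_prod]
  refine Finset.prod_le_prod (fun _ _ => abs_nonneg _) fun x hx => ?_
  rw [Finset.abs_prod]
  refine Finset.prod_le_prod (fun _ _ => abs_nonneg _) fun y hy => ?_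
  split_ifs with hyx
  · exact hGle x hx y hy hyx
  · simpa [hG x y hyx] using hC

lemma two_logb_pos (hq0 : 0 < q) (hq1 : q < 1) (ht0 : 0 < t) (ht1 : t < 1) :
    0 < 2 * Real.logb q t :=
  mul_pos two_pos (Real.logb_pos_of_base_lt_one hq0 hq1 ht0 ht1)

lemma inv_rpow_two_logb_sub_one (hq0 : 0 < q) (hq1 : q < 1) (ht0 : 0 < t) :
    q⁻¹ ^ (2 * Real.logb q t - 1) = q * t⁻¹ / t := by
  rw [Real.inv_rpow hq0.le, Real.rpow_sub hq0, mul_comm, Real.rpow_mul hq0.le,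
    Real.rpow_logb hq0 hq1.ne ht0, Real.rpow_one, Real.rpow_two]
  field_simp

lemma exists_abs_pair_same_sign_le (hq0 : 0 < q) (hq1 : q < 1) (ht0 : 0 < t) (ht1 : t < 1) :
    ∃ C : ℝ, ∀ x y : ℝ, 0 < y → y < x →
      |(x - y) * (x ^ (2 * Real.logb q t - 1) * qPochR q (q * t⁻¹ * y * x⁻¹) /
        qPochR q (t * y * x⁻¹))| ≤ C * x ^ (2 * Real.logb q t) := by
  refine ⟨qPochR q (-(q * t⁻¹)) / qPochR q t, fun x y hy hyx => ?_⟩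
  have hx : 0 < x := hy.trans hyx
  have hu : y * x⁻¹ ≤ 1 := by rw [← div_eq_mul_inv, div_le_one hx]; exact hyx.le
  have h0 := qPochR_pos hq0 hq1 ht1
  have htu : t * y * x⁻¹ ≤ t := by rw [mul_assoc]; exact mul_le_of_le_one_right ht0.le hu
  have h1 := qPochR_anti hq0 hq1 htu ht1.le
  have h2 : |qPochR q (q * t⁻¹ * y * x⁻¹)| ≤ qPochR q (-(q * t⁻¹)) := by
    refine abs_qPochR_le hq0 hq1 ?_
    rw [abs_of_pos (by positivity), mul_assoc (q * t⁻¹)]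
    exact mul_le_of_le_one_right (by positivity) hu
  have h3 : x ^ (2 * Real.logb q t) = x * x ^ (2 * Real.logb q t - 1) := by
    rw [Real.rpow_sub hx, Real.rpow_one]; field_simp
  have h4 : 0 ≤ qPochR q (-(q * t⁻¹)) := (abs_nonneg _).trans h2
  rw [abs_mul, abs_div, abs_mul, abs_of_pos (sub_pos.2 hyx), abs_of_pos (h0.trans_le h1),
    abs_of_nonneg (Real.rpow_nonneg hx.le _), h3]
  calc (x - y) * (x ^ (2 * Real.logb q t - 1) * |qPochR q (q * t⁻¹ * y * x⁻¹)| /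
        qPochR q (t * y * x⁻¹))
      ≤ x * (x ^ (2 * Real.logb q t - 1) * qPochR q (-(q * t⁻¹)) / qPochR q t) := by
        have h5 : 0 ≤ x ^ (2 * Real.logb q t - 1) * |qPochR q (q * t⁻¹ * y * x⁻¹)| /
            qPochR q (t * y * x⁻¹) := div_nonneg (by positivity) (h0.le.trans h1)
        gcongr
        linarith
    _ = _ := by ring

lemma exists_abs_pair_opposite_sign_le (hq0 : 0 < q) (hq1 : q < 1) (ht0 : 0 < t) :
    ∃ C : ℝ, ∀ x y : ℝ, 0 < x → y < 0 →
      |(x - y) * (x ^ (2 * Real.logb q t - 1) * qPochR q (q * t⁻¹ * y * x⁻¹) /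
        qPochR q (t * y * x⁻¹))| ≤ C * (x + |y|) ^ (2 * Real.logb q t) := by
  obtain ⟨C, hC, h⟩ := exists_qPochR_neg_le hq0 hq1 (A := q * t⁻¹) (B := t) (by positivity) ht0
    (inv_rpow_two_logb_sub_one hq0 hq1 ht0)
  refine ⟨C, fun x y hx hy => ?_⟩
  obtain ⟨z, rfl⟩ : ∃ z, y = -z := ⟨-y, by ring⟩
  have hz : 0 < z := by linarith
  have hv : 0 < z * x⁻¹ := by positivity
  have hv1 := h _ hv
  have hA := one_le_qPochR_neg hq0 hq1 (u := q * t⁻¹ * (z * x⁻¹)) (by positivity)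
  have hB := one_le_qPochR_neg hq0 hq1 (u := t * (z * x⁻¹)) (by positivity)
  have e1 : q * t⁻¹ * -z * x⁻¹ = -(q * t⁻¹ * (z * x⁻¹)) := by ring
  have e2 : t * -z * x⁻¹ = -(t * (z * x⁻¹)) := by ring
  have e3 : x ^ (2 * Real.logb q t - 1) * (1 + z * x⁻¹) ^ (2 * Real.logb q t - 1) =
      (x + z) ^ (2 * Real.logb q t - 1) := by
    rw [← Real.mul_rpow hx.le (by positivity)]
    congr 1
    field_simp
  have e4 : (x + z) ^ (2 * Real.logb q t) = (x + z) * (x + z) ^ (2 * Real.logb q t - 1) := by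
    rw [Real.rpow_sub (by positivity), Real.rpow_one]; field_simp
  have hp := Real.rpow_nonneg hx.le (2 * Real.logb q t - 1)
  rw [e1, e2, abs_of_nonneg (by rw [sub_neg_eq_add]; positivity), abs_neg, abs_of_pos hz, e4, ← e3,
    sub_neg_eq_add, mul_div_assoc]
  calc (x + z) * (x ^ (2 * Real.logb q t - 1) *
        (qPochR q (-(q * t⁻¹ * (z * x⁻¹))) / qPochR q (-(t * (z * x⁻¹)))))
      ≤ (x + z) * (x ^ (2 * Real.logb q t - 1) * (C * (1 + z * x⁻¹) ^ (2 * Real.logb q t - 1))) := by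
        gcongr
        rwa [div_le_iff₀ (by linarith)]
    _ = _ := by ring

lemma exists_abs_Vqt_le (hq0 : 0 < q) (hq1 : q < 1) (ht0 : 0 < t) (ht1 : t < 1) (N : ℕ) :
    ∃ K : ℝ, 0 ≤ K ∧ ∀ X : Finset ℝ, X.card = N → (0 : ℝ) ∉ X →
      |Vqt q t X| ≤ K * ∏ x ∈ X, ((1 + |x|) ^ (2 * Real.logb q t)) ^ (N - 1) := by
  obtain ⟨C₁, h₁⟩ := exists_abs_pair_same_sign_le hq0 hq1 ht0 ht1
  obtain ⟨C₂, h₂⟩ := exists_abs_pair_opposite_sign_le hq0 hq1 ht0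
  have hτ := two_logb_pos hq0 hq1 ht0 ht1
  set C := max 1 (max C₁ C₂)
  have hC : 1 ≤ C := le_max_left _ _
  have hC₁ : C₁ ≤ C := (le_max_left _ _).trans (le_max_right _ _)
  have hC₂ : C₂ ≤ C := (le_max_right _ _).trans (le_max_right _ _)
  have hC0 : 0 ≤ C := by linarith
  have hbound : ∀ {D r a b : ℝ}, D ≤ C → 0 < r → r ≤ (1 + |a|) * (1 + |b|) →
      D * r ^ (2 * Real.logb q t) ≤
        C * ((1 + |a|) ^ (2 * Real.logb q t) * (1 + |b|) ^ (2 * Real.logb q t)) := by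
    intro D r a b hD hr hle
    rw [← Real.mul_rpow (by positivity) (by positivity)]
    gcongr
  refine ⟨C ^ (N * N), by positivity, fun X hX h0 => ?_⟩
  subst hX
  rw [Vqt, ← Finset.prod_mul_distrib, ← Finset.prod_mul_distrib]
  simp only [← Finset.prod_mul_distrib]
  refine abs_prod_prod_le X hC (fun x y hyx => by simp [hyx]) fun x hx y hy hyx => ?_
  have hx0 : x ≠ 0 := fun h => h0 (h ▸ hx)
  have hy0 : y ≠ 0 := fun h => h0 (h ▸ hy)
  have hax := abs_nonneg x
  have hay := abs_nonneg y
  rcases hx0.lt_or_gt with hxn | hxp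
  · have h := h₁ (-y) (-x) (by linarith) (by linarith)
    simp only [hyx, hxn, hxn.not_gt, and_true, if_true, if_false, mul_one,
      abs_of_neg (hyx.trans hxn), abs_of_neg hxn]
    rw [inv_neg, mul_neg, mul_neg, neg_mul, neg_neg, mul_neg, mul_neg, neg_mul, neg_neg,
      neg_sub_neg] at h
    refine h.trans ?_
    rw [← abs_of_neg (hyx.trans hxn), ← abs_of_neg hxn]
    exact hbound hC₁ (abs_pos.2 hy0) (by nlinarith)
  · simp only [hyx, hxp, hxp.not_gt, and_true, if_true, if_false, mul_one]
    rcases hy0.lt_or_gt with hyn | hyp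
    · refine (h₂ x y hxp hyn).trans (hbound hC₂ (by positivity) ?_)
      rw [abs_of_pos hxp]
      nlinarith
    · refine (h₁ x y hyp hyx).trans (hbound hC₁ hxp ?_)
      rw [abs_of_pos hxp]
      nlinarith

end Interaction

section Configurations

variable {q t : ℝ}

lemma exists_eq_of_chain (hq : 0 < q) {S : Finset ℝ} {ζ : ℝ}
    (htop : ∀ x ∈ S, 0 < x → (∀ y ∈ S, 0 < y → y ≤ x) → ∃ n : ℤ, x = ζ * q ^ n)
    (hstep : ∀ x ∈ S, ∀ y ∈ S, 0 < y → y < x → (∀ z ∈ S, z ≤ y ∨ x ≤ z) →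
      ∃ k : ℕ, y = x * t * q ^ k)
    {x : ℝ} (hx : x ∈ S) (hx0 : 0 < x) :
    ∃ i < S.card, ∃ n : ℤ, x = ζ * t ^ i * q ^ n := by
  suffices H : ∀ m : ℕ, ∀ x ∈ S, 0 < x → (S.filter (x < ·)).card = m →
      ∃ n : ℤ, x = ζ * t ^ m * q ^ n by
    obtain ⟨n, hn⟩ := H _ x hx hx0 rfl
    refine ⟨_, Finset.card_lt_card (Finset.filter_ssubset.2 ⟨x, hx, lt_irrefl x⟩), n, hn⟩
  intro m
  induction m with
  | zero =>
    intro x hx hx0 hm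
    rw [Finset.card_eq_zero, Finset.filter_eq_empty_iff] at hm
    simpa using htop x hx hx0 fun y hy _ => not_lt.1 (hm hy)
  | succ m ih =>
    intro x hx hx0 hm
    have hne : (S.filter (x < ·)).Nonempty := Finset.card_pos.1 (by omega)
    have hmem := Finset.min'_mem _ hne
    have hle := fun z hz => Finset.min'_le (S.filter (x < ·)) z hz
    set w := (S.filter (x < ·)).min' hne
    obtain ⟨hwS, hxw⟩ := Finset.mem_filter.1 hmem
    have hcard : (S.filter (w < ·)).card = m := by
      have : S.filter (w < ·) = (S.filter (x < ·)).erase w := by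
        ext z
        simp only [Finset.mem_filter, Finset.mem_erase]
        refine ⟨fun h => ⟨h.2.ne', h.1, hxw.trans h.2⟩, fun h => ⟨h.2.1, ?_⟩⟩
        exact lt_of_le_of_ne (hle z (Finset.mem_filter.2 h.2)) (Ne.symm h.1)
      rw [this, Finset.card_erase_of_mem hmem, hm, Nat.add_sub_cancel]
    obtain ⟨n, hn⟩ := ih w hwS (hx0.trans hxw) hcard
    obtain ⟨k, hk⟩ := hstep w hwS x hx hx0 hxw fun z hz => by
      rcases le_or_gt z x with h | h
      · exact Or.inl h
      · exact Or.inr (hle z (Finset.mem_filter.2 ⟨hz, h⟩))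
    refine ⟨n + k, ?_⟩
    rw [hk, hn, zpow_add₀ hq.ne', zpow_natCast]
    ring

/-- All particles of all configurations in `Ω_N` lie on one of `2N` geometric progressions. -/
def particleLattice (q t ζp ζm : ℝ) (N : ℕ) : Set ℝ :=
  ⋃ i ∈ Finset.range N, (Set.range (fun n : ℤ => ζp * t ^ i * q ^ n) ∪
    Set.range (fun n : ℤ => ζm * t ^ i * q ^ n))

lemma mem_particleLattice {ζp ζm : ℝ} {N : ℕ} (hq : 0 < q) {X : Finset ℝ}
    (hX : X ∈ OmegaN q t ζp ζm N) {x : ℝ} (hx : x ∈ X) : x ∈ particleLattice q t ζp ζm N := by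
  obtain ⟨rfl, -, h0, -, -, htop, hbot, hpos, hneg⟩ := hX
  simp only [Finset.mem_coe] at h0 htop hbot hpos hneg
  simp only [particleLattice, Set.mem_iUnion, Finset.mem_range]
  have hx0 : x ≠ 0 := fun h => h0 (h ▸ hx)
  rcases hx0.lt_or_gt with hxn | hxp
  · obtain ⟨i, hi, n, hn⟩ := exists_eq_of_chain (t := t) (ζ := -ζm) (x := -x)
      (S := X.image (- ·)) hq
      (by
        simp only [Finset.forall_mem_image]
        intro x hx hx0 hmax
        obtain ⟨n, hn⟩ := hbot x hx (by linarith) fun y hy hy0 =>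
          neg_le_neg_iff.1 (hmax hy (by linarith))
        exact ⟨n, by rw [hn]; ring⟩)
      (by
        simp only [Finset.forall_mem_image]
        intro x hx y hy hy0 hyx hcons
        obtain ⟨k, hk⟩ := hneg y hy x hx (by linarith) (by linarith) fun z hz => by
          rcases hcons hz with h | h
          · exact Or.inr (by linarith)
          · exact Or.inl (by linarith)
        exact ⟨k, by rw [hk]; ring⟩)
      (Finset.mem_image_of_mem _ hx) (by linarith)
    rw [Finset.card_image_of_injective _ neg_injective] at hi
    exact ⟨i, hi, Or.inr ⟨n, by linear_combination hn⟩⟩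
  · obtain ⟨i, hi, n, hn⟩ := exists_eq_of_chain hq htop hpos hx hxp
    exact ⟨i, hi, Or.inl ⟨n, hn.symm⟩⟩

lemma summable_indicator_particleLattice {ζp ζm : ℝ} {N : ℕ} (hq0 : 0 < q) (hq1 : q < 1)
    (ht : 0 < t) (hζp : ζp ≠ 0) (hζm : ζm ≠ 0) {f : ℝ → ℝ} (hf : ∀ x, 0 ≤ f x)
    (hsum : ∀ z : ℝ, z ≠ 0 → Summable fun n : ℤ => f (z * q ^ n)) :
    Summable ((particleLattice q t ζp ζm N).indicator f) := by
  have horbit : ∀ z : ℝ, z ≠ 0 →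
      Summable ((Set.range fun n : ℤ => z * q ^ n).indicator f) := fun z hz => by
    have hinj : Function.Injective fun n : ℤ => z * q ^ n :=
      (mul_right_injective₀ hz).comp (zpow_right_injective₀ hq0 hq1.ne)
    rw [← hinj.summable_iff (fun x hx => Set.indicator_of_notMem hx f)]
    refine (hsum z hz).congr fun n => ?_
    rw [Function.comp_apply, Set.indicator_of_mem (Set.mem_range_self n)]
  refine Summable.of_nonneg_of_le (fun x => Set.indicator_nonneg (fun x _ => hf x) x) (fun x => ?_)
    (summable_sum (s := Finset.range N) fun i _ =>
      (horbit (ζp * t ^ i) (by positivity)).add (horbit (ζm * t ^ i) (by positivity)))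
  have hnn : ∀ s : Set ℝ, 0 ≤ s.indicator f x := fun s => Set.indicator_nonneg (fun x _ => hf x) x
  have hterm : ∀ i ∈ Finset.range N, 0 ≤ (Set.range fun n : ℤ => ζp * t ^ i * q ^ n).indicator f x +
      (Set.range fun n : ℤ => ζm * t ^ i * q ^ n).indicator f x :=
    fun i _ => add_nonneg (hnn _) (hnn _)
  by_cases hx : x ∈ particleLattice q t ζp ζm N
  · rw [Set.indicator_of_mem hx]
    simp only [particleLattice, Set.mem_iUnion] at hx
    obtain ⟨i, hi, h | h⟩ := hx
    · refine le_trans ?_ (Finset.single_le_sum hterm hi)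
      rw [Set.indicator_of_mem h]
      linarith [hnn (Set.range fun n : ℤ => ζm * t ^ i * q ^ n)]
    · refine le_trans ?_ (Finset.single_le_sum hterm hi)
      rw [Set.indicator_of_mem h]
      linarith [hnn (Set.range fun n : ℤ => ζp * t ^ i * q ^ n)]
  · rw [Set.indicator_of_notMem hx]
    exact Finset.sum_nonneg hterm

end Configurations

section OneParticle

variable {q : ℝ}

/-- A bound, uniform for `|a| ≤ R₁` and `|b| ≤ R₂`, for `|W(x; q; a,b,c,d)| (1 + |x|)^E`. -/
noncomputable def weightBound (q R₁ R₂ E : ℝ) (c d : ℂ) (x : ℝ) : ℝ :=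
  |x| * (1 + |x|) ^ E * (qPochR q (-(R₁ * |x|)) * qPochR q (-(R₂ * |x|))) /
    (‖qPochC q (c * x)‖ * ‖qPochC q (d * x)‖)

/-- The quotient of the values of `weightBound` at `q * x` and `x`. -/
noncomputable def weightRatio (q R₁ R₂ E : ℝ) (c d : ℂ) (x : ℝ) : ℝ :=
  q * ((1 + q * |x|) / (1 + |x|)) ^ E * (‖1 - c * x‖ * ‖1 - d * x‖) /
    ((1 + R₁ * |x|) * (1 + R₂ * |x|))

variable {R₁ R₂ E : ℝ} {c d : ℂ}

lemma weightBound_pos (hq0 : 0 < q) (hq1 : q < 1) (hR₁ : 0 < R₁) (hR₂ : 0 < R₂)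
    (hc : c.im ≠ 0) (hd : d.im ≠ 0) {x : ℝ} (hx : x ≠ 0) : 0 < weightBound q R₁ R₂ E c d x := by
  have h1 := one_le_qPochR_neg hq0 hq1 (u := R₁ * |x|) (by positivity)
  have h2 := one_le_qPochR_neg hq0 hq1 (u := R₂ * |x|) (by positivity)
  have h3 := norm_pos_iff.2 (qPochC_ne_zero hq0 hq1 hc x)
  have h4 := norm_pos_iff.2 (qPochC_ne_zero hq0 hq1 hd x)
  have h5 := abs_pos.2 hx
  unfold weightBound
  positivity

lemma weightBound_nonneg (hq0 : 0 < q) (hq1 : q < 1) (hR₁ : 0 < R₁) (hR₂ : 0 < R₂)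
    (x : ℝ) : 0 ≤ weightBound q R₁ R₂ E c d x := by
  have h1 := one_le_qPochR_neg hq0 hq1 (u := R₁ * |x|) (by positivity)
  have h2 := one_le_qPochR_neg hq0 hq1 (u := R₂ * |x|) (by positivity)
  unfold weightBound
  positivity

lemma norm_one_sub_mul_pos (hc : c.im ≠ 0) (x : ℝ) : 0 < ‖1 - c * x‖ := by
  rw [norm_pos_iff]
  intro h
  have h1 := congrArg Complex.im h
  have h2 := congrArg Complex.re h
  rw [Complex.sub_im, Complex.im_mul_ofReal] at h1
  rw [Complex.sub_re, Complex.re_mul_ofReal] at h2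
  have : x = 0 := by simpa [hc] using h1
  simp [this] at h2

lemma weightRatio_pos (hq0 : 0 < q) (hR₁ : 0 < R₁) (hR₂ : 0 < R₂)
    (hc : c.im ≠ 0) (hd : d.im ≠ 0) (x : ℝ) : 0 < weightRatio q R₁ R₂ E c d x := by
  have h3 := norm_one_sub_mul_pos hc x
  have h4 := norm_one_sub_mul_pos hd x
  unfold weightRatio
  positivity

lemma weightBound_mul (hq0 : 0 < q) (hq1 : q < 1) (hR₁ : 0 < R₁) (hR₂ : 0 < R₂)
    (hc : c.im ≠ 0) (hd : d.im ≠ 0) (x : ℝ) :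
    weightBound q R₁ R₂ E c d (x * q) =
      weightRatio q R₁ R₂ E c d x * weightBound q R₁ R₂ E c d x := by
  have h3 := (norm_one_sub_mul_pos hc x).ne'
  have h4 := (norm_one_sub_mul_pos hd x).ne'
  have h5 := norm_ne_zero_iff.2 (qPochC_ne_zero hq0 hq1 hc (x * q))
  have h6 := norm_ne_zero_iff.2 (qPochC_ne_zero hq0 hq1 hd (x * q))
  have h7 : (1 + |x|) ^ E ≠ 0 := by positivity
  have e : ∀ R : ℝ, qPochR q (-(R * |x|)) = (1 + R * |x|) * qPochR q (-(R * (|x| * q))) :=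
    fun R => by rw [qPochR_succ hq0 hq1, sub_neg_eq_add, neg_mul, mul_assoc]
  have e' : ∀ c : ℂ, qPochC q (c * x) = (1 - c * x) * qPochC q (c * (x * q : ℝ)) := fun c => by
    rw [qPochC_succ hq0 hq1]; push_cast; rw [mul_assoc]
  unfold weightBound weightRatio
  rw [e R₁, e R₂, e' c, e' d, norm_mul, norm_mul, abs_mul, abs_of_pos hq0,
    Real.div_rpow (by positivity) (by positivity), mul_comm q |x|]
  field_simp

lemma tendsto_weightRatio_zero : Tendsto (weightRatio q R₁ R₂ E c d) (𝓝 0) (𝓝 q) := by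
  have h : ContinuousAt (weightRatio q R₁ R₂ E c d) 0 := by
    unfold weightRatio
    refine ContinuousAt.div (ContinuousAt.mul (ContinuousAt.mul continuousAt_const
      (ContinuousAt.rpow_const (ContinuousAt.div (by fun_prop) (by fun_prop) (by simp))
      (by simp))) (by fun_prop)) (by fun_prop) (by simp)
  simpa [ContinuousAt, weightRatio] using h

lemma weightRatio_inv {y : ℝ} (hy : y ≠ 0) :
    weightRatio q R₁ R₂ E c d y⁻¹ = q * ((|y| + q) / (|y| + 1)) ^ E * (‖y - c‖ * ‖y - d‖) /
      ((|y| + R₁) * (|y| + R₂)) := by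
  have hy' : |y| ≠ 0 := abs_ne_zero.2 hy
  have e : ∀ c : ℂ, ‖1 - c * (y⁻¹ : ℝ)‖ = ‖y - c‖ / |y| := fun c => by
    have hyc : (y : ℂ) ≠ 0 := by exact_mod_cast hy
    rw [← Real.norm_eq_abs, ← Complex.norm_real, ← norm_div]
    congr 1
    push_cast
    field_simp
  have e1 : (1 + q * |y|⁻¹) / (1 + |y|⁻¹) = (|y| + q) / (|y| + 1) := by field_simp
  have e2 : ∀ R : ℝ, 1 + R * |y|⁻¹ = (|y| + R) / |y| := fun R => by field_simp
  unfold weightRatio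
  rw [e, e, abs_inv, e1, e2, e2]
  field_simp

lemma tendsto_weightRatio_inv (hq0 : 0 < q) (hR₁ : 0 < R₁) (hR₂ : 0 < R₂) :
    Tendsto (fun y => weightRatio q R₁ R₂ E c d y⁻¹) (𝓝[≠] 0)
      (𝓝 (q * q ^ E * (‖c‖ * ‖d‖) / (R₁ * R₂))) := by
  have h : ContinuousAt (fun y : ℝ => q * ((|y| + q) / (|y| + 1)) ^ E * (‖y - c‖ * ‖y - d‖) /
      ((|y| + R₁) * (|y| + R₂))) 0 := by
    refine ContinuousAt.div (ContinuousAt.mul (ContinuousAt.mul continuousAt_const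
      (ContinuousAt.rpow_const (ContinuousAt.div (by fun_prop) (by fun_prop) (by simp))
      (by simp [hq0.ne']))) (by fun_prop)) (by fun_prop) (by simp [hR₁.ne', hR₂.ne'])
  have h' : Tendsto _ _ _ := h.tendsto.mono_left (nhdsWithin_le_nhds (s := {0}ᶜ))
  simp only [abs_zero, zero_add, div_one, Complex.ofReal_zero, zero_sub, norm_neg] at h'
  refine h'.congr' ?_
  filter_upwards [self_mem_nhdsWithin] with y hy
  exact (weightRatio_inv hy).symm

lemma summable_weightBound (hq0 : 0 < q) (hq1 : q < 1) (hR₁ : 0 < R₁) (hR₂ : 0 < R₂)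
    (hc : c.im ≠ 0) (hd : d.im ≠ 0) (hRR : R₁ * R₂ < ‖c‖ * ‖d‖ * (q * q ^ E))
    {z : ℝ} (hz : z ≠ 0) : Summable fun n : ℤ => weightBound q R₁ R₂ E c d (z * q ^ n) := by
  have hne : ∀ n : ℕ, z * q ^ n ≠ 0 := fun n => by positivity
  have hne' : ∀ n : ℕ, z * (q ^ n)⁻¹ ≠ 0 := fun n => by positivity
  have hqn := tendsto_pow_atTop_nhds_zero_of_lt_one hq0.le hq1
  refine Summable.of_nat_of_neg ?_ ?_
  · simp only [zpow_natCast]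
    refine summable_of_ratio_test_tendsto_lt_one hq1 (.of_forall fun n =>
      (weightBound_pos hq0 hq1 hR₁ hR₂ hc hd (hne n)).ne') ?_
    have h0 : Tendsto (fun n : ℕ => z * q ^ n) atTop (𝓝 0) := by simpa using hqn.const_mul z
    refine ((tendsto_weightRatio_zero (R₁ := R₁) (R₂ := R₂) (E := E) (c := c) (d := d)).comp
      h0).congr fun n => ?_
    have hp := weightBound_pos (E := E) hq0 hq1 hR₁ hR₂ hc hd (hne n)
    rw [Function.comp_apply, pow_succ, ← mul_assoc, weightBound_mul hq0 hq1 hR₁ hR₂ hc hd, norm_mul,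
      mul_div_cancel_right₀ _ (norm_ne_zero_iff.2 hp.ne'),
      Real.norm_of_nonneg (weightRatio_pos hq0 hR₁ hR₂ hc hd _).le]
  · simp only [zpow_neg, zpow_natCast]
    have hlim : 1 < q * q ^ E * (‖c‖ * ‖d‖) / (R₁ * R₂) := by
      rw [one_lt_div (by positivity)]
      linarith
    refine summable_of_ratio_test_tendsto_lt_one (inv_lt_one_of_one_lt₀ hlim)
      (.of_forall fun n => (weightBound_pos hq0 hq1 hR₁ hR₂ hc hd (hne' n)).ne') ?_
    have h0 : Tendsto (fun n : ℕ => z⁻¹ * q ^ (n + 1)) atTop (𝓝[≠] 0) := by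
      refine tendsto_nhdsWithin_iff.2 ⟨?_, .of_forall fun n => ?_⟩
      · simpa using (hqn.comp (tendsto_add_atTop_nat 1)).const_mul z⁻¹
      · have : z⁻¹ * q ^ (n + 1) ≠ 0 := by positivity
        exact this
    refine (((tendsto_weightRatio_inv hq0 hR₁ hR₂).comp h0).inv₀ (by positivity)).congr fun n => ?_
    have hstep : z * (q ^ n)⁻¹ = z * (q ^ (n + 1))⁻¹ * q := by
      rw [pow_succ]; field_simp
    have hp := weightBound_pos (E := E) hq0 hq1 hR₁ hR₂ hc hd (hne' (n + 1))
    have hr := weightRatio_pos (E := E) hq0 hR₁ hR₂ hc hd (z * (q ^ (n + 1))⁻¹)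
    rw [Function.comp_apply, hstep, weightBound_mul hq0 hq1 hR₁ hR₂ hc hd, norm_mul,
      Real.norm_of_nonneg hr.le, div_mul_cancel_right₀ (norm_ne_zero_iff.2 hp.ne'),
      mul_inv, inv_inv]

lemma norm_Wc_mul_le (hq0 : 0 < q) (hq1 : q < 1) {a b : ℂ} (ha : ‖a‖ ≤ R₁) (hb : ‖b‖ ≤ R₂)
    (x : ℝ) : (1 + |x|) ^ E * ‖Wc q a b c d x‖ ≤ weightBound q R₁ R₂ E c d x := by
  have h : ∀ {a : ℂ} {R : ℝ}, ‖a‖ ≤ R → ‖qPochC q (a * x)‖ ≤ qPochR q (-(R * |x|)) :=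
    fun {a R} ha => norm_qPochC_le hq0 hq1 (by
      rw [norm_mul, Complex.norm_real, Real.norm_eq_abs]; gcongr)
  have h1 := h ha
  have h2 := h hb
  have h3 := (norm_nonneg _).trans h1
  have h4 := (norm_nonneg _).trans h2
  have hx : ‖(((1 - q) * |x| : ℝ) : ℂ)‖ ≤ |x| := by
    rw [Complex.norm_real, Real.norm_of_nonneg (mul_nonneg (by linarith) (abs_nonneg x))]
    exact mul_le_of_le_one_left (abs_nonneg x) (by linarith)
  unfold Wc weightBound
  rw [norm_div, norm_mul, norm_mul, norm_mul, mul_comm |x|, mul_assoc, ← mul_div_assoc]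
  gcongr

end OneParticle

section Domination

variable {q t : ℝ}

lemma exists_norm_Mtilde_le (hq0 : 0 < q) (hq1 : q < 1) (ht0 : 0 < t) (ht1 : t < 1)
    (ζp ζm : ℝ) {N : ℕ} (hN : 1 ≤ N) (c d : ℂ) (R₁ R₂ : ℝ) :
    ∃ K : ℝ, 0 ≤ K ∧ ∀ a b : ℂ, ‖a‖ ≤ R₁ → ‖b‖ ≤ R₂ → ∀ X ∈ OmegaN q t ζp ζm N,
      ‖Mtilde q t ζp ζm N a b c d X‖ ≤
        K * ∏ x ∈ X, weightBound q R₁ R₂ (2 * Real.logb q t * ((N : ℝ) - 1)) c d x := by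
  obtain ⟨K, hK, hV⟩ := exists_abs_Vqt_le hq0 hq1 ht0 ht1 N
  set L := ∑ k ∈ Finset.range (N + 1), |CNconst q t ζp ζm N k|
  have hL : 0 ≤ L := Finset.sum_nonneg fun _ _ => abs_nonneg _
  refine ⟨L * K, by positivity, fun a b ha hb X hX => ?_⟩
  have hC : |CNconst q t ζp ζm N (X.filter (fun x => 0 < x)).card| ≤ L :=
    Finset.single_le_sum (f := fun k => |CNconst q t ζp ζm N k|) (fun _ _ => abs_nonneg _)
      (Finset.mem_range_succ_iff.2 (hX.1 ▸ Finset.card_filter_le _ _))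
  have hpow : ∀ x : ℝ, ((1 + |x|) ^ (2 * Real.logb q t)) ^ (N - 1) =
      (1 + |x|) ^ (2 * Real.logb q t * ((N : ℝ) - 1)) := fun x => by
    rw [← Real.rpow_natCast, ← Real.rpow_mul (by positivity), Nat.cast_sub hN, Nat.cast_one]
  have hVX := hV X hX.1 (by simpa using hX.2.2.1)
  simp only [hpow] at hVX
  rw [Mtilde, norm_mul, norm_prod, Complex.norm_real, norm_mul, Real.norm_eq_abs, Real.norm_eq_abs]
  calc _ ≤ L * (K * ∏ x ∈ X, (1 + |x|) ^ (2 * Real.logb q t * ((N : ℝ) - 1))) *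
        ∏ x ∈ X, ‖Wc q a b c d x‖ := by gcongr
    _ = L * K * ∏ x ∈ X, (1 + |x|) ^ (2 * Real.logb q t * ((N : ℝ) - 1)) * ‖Wc q a b c d x‖ := by
        rw [Finset.prod_mul_distrib]; ring
    _ ≤ _ := by
        gcongr with x hx
        exact norm_Wc_mul_le hq0 hq1 ha hb x

/-- A family dominated by a common summable majorant has uniformly small tails. -/
lemma summable_and_tail_lt_of_le {α ι : Type*} {s : Set α} {p : ι → Prop} {f : ι → α → ℝ}
    {D : α → ℝ} (hD : Summable D) (hD0 : ∀ x, 0 ≤ D x) (hf0 : ∀ i x, 0 ≤ f i x)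
    (hf : ∀ i, p i → ∀ x ∈ s, f i x ≤ D x) :
    (∀ i, p i → Summable fun x : s => f i x) ∧
      ∀ ε : ℝ, 0 < ε → ∃ F : Finset α, ∀ i, p i →
        ∑' x : {x // x ∈ s ∧ x ∉ F}, f i x < ε := by
  refine ⟨fun i hi => Summable.of_nonneg_of_le (fun x => hf0 i x) (fun x => hf i hi x x.2)
    (hD.subtype s), fun ε hε => ?_⟩
  obtain ⟨F, hF⟩ := ((tendsto_order.1 (tendsto_tsum_compl_atTop_zero D)).2 ε hε).exists
  refine ⟨F, fun i hi => lt_of_le_of_lt ?_ hF⟩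
  have hle : ∀ x : {x // x ∈ s ∧ x ∉ F}, f i x ≤ D x := fun x => hf i hi x x.2.1
  refine Summable.tsum_le_tsum_of_inj (fun x : {x // x ∈ s ∧ x ∉ F} => (⟨x, x.2.2⟩ : {x // x ∉ F}))
    (fun x y h => Subtype.ext (congrArg (fun z : {x // x ∉ F} => (z : α)) h)) (fun x _ => hD0 x) hle
    (Summable.of_nonneg_of_le (fun x => hf0 i x) hle (hD.subtype {x | x ∈ s ∧ x ∉ F}))
    (hD.subtype {x | x ∉ F})

end Domination

/-- Uniform summability on the bidisc `{|a| ≤ R₁, |b| ≤ R₂}` with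
`R₁R₂ < R² q^{2τ(N-1)+1}` (`R = |c|`): the weights are summable for every such `(a,b)`,
and for every `ε > 0` there is a finite set `F` of configurations such that the tail sum
over `Ω_N ∖ F` is `< ε` simultaneously for all `(a,b)` in the bidisc. -/
theorem stmt9 (q t ζp ζm : ℝ) (hq0 : 0 < q) (hq1 : q < 1) (ht0 : 0 < t) (ht1 : t < 1)
    (hζp : 0 < ζp) (hζm : ζm < 0) (N : ℕ) (hN : 1 ≤ N)
    (c d : ℂ) (hcd : c = (starRingEnd ℂ) d) (hc : c.im ≠ 0)
    (R₁ R₂ : ℝ) (hR₁ : 0 < R₁) (hR₂ : 0 < R₂)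
    (hRR : R₁ * R₂ < ‖c‖ ^ 2 * q ^ (2 * Real.logb q t * ((N : ℝ) - 1) + 1)) :
    (∀ a b : ℂ, ‖a‖ ≤ R₁ → ‖b‖ ≤ R₂ →
      Summable (fun X : OmegaN q t ζp ζm N => ‖Mtilde q t ζp ζm N a b c d (X : Finset ℝ)‖)) ∧
    ∀ ε : ℝ, 0 < ε → ∃ F : Finset (Finset ℝ),
      ∀ a b : ℂ, ‖a‖ ≤ R₁ → ‖b‖ ≤ R₂ →
        (∑' X : {X : Finset ℝ // X ∈ OmegaN q t ζp ζm N ∧ X ∉ F},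
          ‖Mtilde q t ζp ζm N a b c d (X : Finset ℝ)‖) < ε := by
  have hd : d.im ≠ 0 := fun h => hc (by rw [hcd, Complex.conj_im, h, neg_zero])
  have hnorm : ‖c‖ = ‖d‖ := by rw [hcd, Complex.norm_conj]
  set E := 2 * Real.logb q t * ((N : ℝ) - 1) with hE
  have hRR' : R₁ * R₂ < ‖c‖ * ‖d‖ * (q * q ^ E) := by
    rwa [← hnorm, ← sq, mul_comm q, ← Real.rpow_add_one hq0.ne']
  obtain ⟨K, hK, hM⟩ := exists_norm_Mtilde_le hq0 hq1 ht0 ht1 ζp ζm hN c d R₁ R₂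
  rw [← hE] at hM
  have hw := weightBound_nonneg (E := E) (c := c) (d := d) hq0 hq1 hR₁ hR₂
  set φ := (particleLattice q t ζp ζm N).indicator (weightBound q R₁ R₂ E c d) with hφ
  have hφ0 : ∀ x, 0 ≤ φ x := fun x => Set.indicator_nonneg (fun x _ => hw x) x
  have hφsum : Summable φ := summable_indicator_particleLattice hq0 hq1 ht0 hζp.ne' hζm.ne hw
    fun z hz => summable_weightBound hq0 hq1 hR₁ hR₂ hc hd hRR' hz
  have key := summable_and_tail_lt_of_le (s := OmegaN q t ζp ζm N)
    (p := fun ab : ℂ × ℂ => ‖ab.1‖ ≤ R₁ ∧ ‖ab.2‖ ≤ R₂)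
    (f := fun ab X => ‖Mtilde q t ζp ζm N ab.1 ab.2 c d X‖)
    ((summable_finsetProd_of_summable_nonneg hφ0 hφsum).mul_left K)
    (fun X => mul_nonneg hK (Finset.prod_nonneg fun x _ => hφ0 x)) (fun _ _ => norm_nonneg _)
    (fun ab hab X hX => by
      refine (hM ab.1 ab.2 hab.1 hab.2 X hX).trans_eq ?_
      congr 1
      exact Finset.prod_congr rfl fun x hx =>
        (Set.indicator_of_mem (mem_particleLattice hq0 hX hx) _).symm)
  refine ⟨fun a b ha hb => key.1 (a, b) ⟨ha, hb⟩, fun ε hε => ?_⟩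
  obtain ⟨F, hF⟩ := key.2 ε hε
  exact ⟨F, fun a b ha hb => hF (a, b) ⟨ha, hb⟩⟩
end

section
/- Fix q, t ∈ (0,1), ζ₊ > 0, ζ₋ < 0, N ∈ ℤ_{≥1}, and real numbers l < 0 < r. Then the closure of Ω_N[l,r] in Ω̃ equals Ω̃_N[l,r] = ⋃_{n=0}^N Ω_n[l,r], and this set is compact in Ω̃. -/
/-- The space `Ω̃` of all (finite or infinite) configurations. -/
def OmegaTilde (q t ζp ζm : ℝ) : Type := {X : Set ℝ // IsConfig q t ζp ζm X}

/-- The topology on a space of configurations determined by the uniform structure in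
which two configurations are ε-close iff they coincide outside `(-ε, ε)`. -/
def configTop {Γ : Type} (pts : Γ → Set ℝ) : TopologicalSpace Γ :=
  TopologicalSpace.generateFrom
    {S | ∃ (Y : Γ) (ε : ℝ), 0 < ε ∧ S = {Z | ∀ x : ℝ, ε ≤ |x| → (x ∈ pts Y ↔ x ∈ pts Z)}}

/-- The topology of `Ω̃`. -/
noncomputable def cylTop (q t ζp ζm : ℝ) : TopologicalSpace (OmegaTilde q t ζp ζm) :=
  configTop (fun X => X.1)

open Filter Topology Set

section Configurations

variable {q t ζp ζm : ℝ}

/-- The configurations that coincide with `Y` outside `(-ε, ε)`. -/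
def cylinder (Y : OmegaTilde q t ζp ζm) (ε : ℝ) : Set (OmegaTilde q t ζp ζm) :=
  {Z | ∀ x : ℝ, ε ≤ |x| → (x ∈ Y.1 ↔ x ∈ Z.1)}

lemma cylinder_subset_of_le (Y : OmegaTilde q t ζp ζm) {ε δ : ℝ} (h : ε ≤ δ) :
    cylinder Y ε ⊆ cylinder Y δ :=
  fun _ hZ x hx => hZ x (h.trans hx)

lemma cylinder_subset_of_mem {Y Z : OmegaTilde q t ζp ζm} {ε : ℝ} (h : Z ∈ cylinder Y ε) :
    cylinder Z ε ⊆ cylinder Y ε :=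
  fun _ hW x hx => (h x hx).trans (hW x hx)

lemma mem_cylinder_self (Y : OmegaTilde q t ζp ζm) (ε : ℝ) : Y ∈ cylinder Y ε :=
  fun _ _ => Iff.rfl

lemma exists_cylinder_subset_of_isOpen {U : Set (OmegaTilde q t ζp ζm)}
    (hU : @IsOpen _ (cylTop q t ζp ζm) U) (Y : OmegaTilde q t ζp ζm) (hY : Y ∈ U) :
    ∃ ε > 0, cylinder Y ε ⊆ U := by
  have hU' : TopologicalSpace.GenerateOpen
      {S | ∃ (Y : OmegaTilde q t ζp ζm) (ε : ℝ), 0 < ε ∧ S = cylinder Y ε} U := hU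
  clear hU
  induction hU' with
  | basic S hS =>
    obtain ⟨W, ε, hε, rfl⟩ := hS
    exact ⟨ε, hε, cylinder_subset_of_mem hY⟩
  | univ => exact ⟨1, one_pos, subset_univ _⟩
  | inter S T _ _ ihS ihT =>
    obtain ⟨ε, hε, hS⟩ := ihS hY.1
    obtain ⟨δ, hδ, hT⟩ := ihT hY.2
    exact ⟨min ε δ, lt_min hε hδ, subset_inter
      ((cylinder_subset_of_le Y (min_le_left _ _)).trans hS)
      ((cylinder_subset_of_le Y (min_le_right _ _)).trans hT)⟩
  | sUnion 𝒮 _ ih =>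
    obtain ⟨S, hS, hYS⟩ := hY
    obtain ⟨ε, hε, h⟩ := ih S hS hYS
    exact ⟨ε, hε, h.trans (subset_sUnion_of_mem hS)⟩

lemma nhds_cylTop_hasBasis (Y : OmegaTilde q t ζp ζm) :
    (@nhds _ (cylTop q t ζp ζm) Y).HasBasis (fun ε : ℝ => 0 < ε) (cylinder Y) := by
  let _ := cylTop q t ζp ζm
  refine ⟨fun S => ⟨fun hS => ?_, fun ⟨ε, hε, h⟩ => ?_⟩⟩
  · obtain ⟨U, hUS, hU, hY⟩ := mem_nhds_iff.1 hS
    obtain ⟨ε, hε, h⟩ := exists_cylinder_subset_of_isOpen hU Y hY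
    exact ⟨ε, hε, h.trans hUS⟩
  · exact mem_nhds_iff.2 ⟨cylinder Y ε, h,
      TopologicalSpace.isOpen_generateFrom_of_mem ⟨Y, ε, hε, rfl⟩, mem_cylinder_self Y ε⟩

/-- Reflection through the origin exchanges the roles of the two half-lattices. -/
lemma IsConfig.neg {X : Set ℝ} (h : IsConfig q t ζp ζm X) :
    IsConfig q t (-ζm) (-ζp) (-X) := by
  obtain ⟨h1, h2, h3, h4, h5, h6, h7, h8⟩ := h
  refine ⟨?_, by simpa using h2, ?_, ?_, ?_, ?_, ?_, ?_⟩
  · rw [← Set.image_neg_eq_neg]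
    exact h1.image _
  · intro x hx h0
    refine ((h4 (-x) hx (by linarith)).image Neg.neg).subset ?_
    rintro y ⟨hy, hxy⟩
    exact ⟨-y, ⟨hy, by linarith⟩, neg_neg y⟩
  · intro x hx h0
    refine ((h3 (-x) hx (by linarith)).image Neg.neg).subset ?_
    rintro y ⟨hy, hxy⟩
    exact ⟨-y, ⟨hy, by linarith⟩, neg_neg y⟩
  · intro x hx h0 hmax
    obtain ⟨n, hn⟩ := h6 (-x) hx (by linarith) fun y hy hy0 => by
      linarith [hmax (-y) (by simpa using hy) (by linarith)]
    exact ⟨n, by linarith⟩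
  · intro x hx h0 hmax
    obtain ⟨n, hn⟩ := h5 (-x) hx (by linarith) fun y hy hy0 => by
      linarith [hmax (-y) (by simpa using hy) (by linarith)]
    exact ⟨n, by linarith⟩
  · intro x hx y hy hy0 hyx hgap
    obtain ⟨k, hk⟩ := h8 (-y) hy (-x) hx (by linarith) (by linarith) fun z hz => by
      rcases hgap (-z) (by simpa using hz) with h | h
      · right; linarith
      · left; linarith
    exact ⟨k, by linarith⟩
  · intro x hx y hy hyx hx0 hgap
    obtain ⟨k, hk⟩ := h7 (-y) hy (-x) hx (by linarith) (by linarith) fun z hz => by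
      rcases hgap (-z) (by simpa using hz) with h | h
      · right; linarith
      · left; linarith
    exact ⟨k, by linarith⟩

/-- Erasing all points of a configuration inside `(-ε, ε)` leaves a configuration. -/
lemma IsConfig.of_agree {X Z : Set ℝ} {ε : ℝ} (hZ : IsConfig q t ζp ζm Z) (hX : X.Finite)
    (hε : 0 < ε) (hXε : ∀ x ∈ X, ε ≤ |x|) (hXZ : ∀ x : ℝ, ε ≤ |x| → (x ∈ X ↔ x ∈ Z)) :
    IsConfig q t ζp ζm X := by
  obtain ⟨-, -, -, -, h5, h6, h7, h8⟩ := hZ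
  have hsub : ∀ x ∈ X, x ∈ Z := fun x hx => (hXZ x (hXε x hx)).1 hx
  have hpos : ∀ x ∈ X, 0 < x → ε ≤ x := fun x hx h0 => abs_of_pos h0 ▸ hXε x hx
  have hneg : ∀ x ∈ X, x < 0 → x ≤ -ε := fun x hx h0 => by
    have := hXε x hx
    rw [abs_of_neg h0] at this
    linarith
  have hback : ∀ z ∈ Z, z ∈ X ∨ -ε < z ∧ z < ε := fun z hz => by
    rcases le_or_gt ε |z| with h | h
    · exact Or.inl ((hXZ z h).2 hz)
    · exact Or.inr (abs_lt.1 h)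
  refine ⟨hX.countable, fun h0 => ?_, fun x _ _ => hX.subset (sep_subset _ _),
    fun x _ _ => hX.subset (sep_subset _ _), ?_, ?_, ?_, ?_⟩
  · have := hXε 0 h0
    rw [abs_zero] at this
    linarith
  · intro x hx h0 hmax
    refine h5 x (hsub x hx) h0 fun y hy hy0 => ?_
    rcases hback y hy with h | h
    · exact hmax y h hy0
    · linarith [hpos x hx h0]
  · intro x hx h0 hmax
    refine h6 x (hsub x hx) h0 fun y hy hy0 => ?_
    rcases hback y hy with h | h
    · exact hmax y h hy0
    · linarith [hneg x hx h0]
  · intro x hx y hy hy0 hyx hgap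
    refine h7 x (hsub x hx) y (hsub y hy) hy0 hyx fun z hz => ?_
    rcases hback z hz with h | h
    · exact hgap z h
    · left; linarith [hpos y hy hy0]
  · intro x hx y hy hyx hx0 hgap
    refine h8 x (hsub x hx) y (hsub y hy) hyx hx0 fun z hz => ?_
    rcases hback z hz with h | h
    · exact hgap z h
    · right; linarith [hneg x hx hx0]

/-- Adjoining an innermost positive point to a finite configuration. -/
lemma IsConfig.insert_of_lt {X : Set ℝ} (h : IsConfig q t ζp ζm X) (hX : X.Finite) {y : ℝ}
    (hy0 : 0 < y) (hlt : ∀ x ∈ X, 0 < x → y < x)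
    (hout : (∀ x ∈ X, x ≤ 0) → ∃ n : ℤ, y = ζp * q ^ n)
    (hin : ∀ x ∈ X, 0 < x → (∀ z ∈ X, 0 < z → x ≤ z) → ∃ k : ℕ, y = x * t * q ^ k) :
    IsConfig q t ζp ζm (insert y X) := by
  have hfin : (insert y X).Finite := hX.insert y
  obtain ⟨-, h2, -, -, h5, h6, h7, h8⟩ := h
  refine ⟨hfin.countable, ?_, fun x _ _ => hfin.subset (sep_subset _ _),
    fun x _ _ => hfin.subset (sep_subset _ _), ?_, ?_, ?_, ?_⟩
  · rintro (h | h)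
    · exact hy0.ne h
    · exact h2 h
  · rintro x (rfl | hx) h0 hmax
    · refine hout fun z hz => ?_
      by_contra! hz0
      linarith [hmax z (mem_insert_of_mem _ hz) hz0, hlt z hz hz0]
    · exact h5 x hx h0 fun z hz => hmax z (mem_insert_of_mem _ hz)
  · rintro x (rfl | hx) h0 hmax
    · linarith
    · exact h6 x hx h0 fun z hz => hmax z (mem_insert_of_mem _ hz)
  · rintro x (rfl | hx) z (rfl | hz) hz0 hzx hgap
    · exact absurd hzx (lt_irrefl _)
    · linarith [hlt z hz hz0]
    · refine hin x hx (by linarith) fun w hw hw0 => ?_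
      rcases hgap w (mem_insert_of_mem _ hw) with h | h
      · linarith [hlt w hw hw0]
      · exact h
    · exact h7 x hx z hz hz0 hzx fun w hw => hgap w (mem_insert_of_mem _ hw)
  · rintro x (rfl | hx) z (rfl | hz) hzx hx0 hgap
    · linarith
    · linarith
    · linarith
    · exact h8 x hx z hz hzx hx0 fun w hw => hgap w (mem_insert_of_mem _ hw)

/-- A finite configuration can be enlarged by one point arbitrarily close to `0`. -/
lemma IsConfig.exists_insert (hq0 : 0 < q) (hq1 : q < 1) (ht0 : 0 < t) (ht1 : t < 1)
    (hζp : 0 < ζp) {X : Set ℝ} (h : IsConfig q t ζp ζm X) (hX : X.Finite) {ε : ℝ} (hε : 0 < ε) :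
    ∃ y, 0 < y ∧ y < ε ∧ y ∉ X ∧ IsConfig q t ζp ζm (insert y X) := by
  have hsmall : ∀ c > 0, ∃ k : ℕ, c * q ^ k < ε := fun c hc => by
    obtain ⟨k, hk⟩ := exists_pow_lt_of_lt_one (div_pos hε hc) hq1
    exact ⟨k, by rwa [lt_div_iff₀' hc] at hk⟩
  by_cases hpos : ∃ x ∈ X, 0 < x
  · obtain ⟨x, ⟨hx, hx0⟩, hmin⟩ := Set.exists_min_image {x ∈ X | 0 < x} id
      (hX.subset (sep_subset _ _)) hpos
    simp only [id] at hmin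
    obtain ⟨k, hk⟩ := hsmall (x * t) (by positivity)
    have hyx : x * t * q ^ k < x := by
      have : x * t * q ^ k ≤ x * t :=
        mul_le_of_le_one_right (by positivity) (pow_le_one₀ hq0.le hq1.le)
      nlinarith
    have hlt : ∀ z ∈ X, 0 < z → x * t * q ^ k < z := fun z hz hz0 =>
      hyx.trans_le (hmin z ⟨hz, hz0⟩)
    have hy0 : 0 < x * t * q ^ k := by positivity
    refine ⟨x * t * q ^ k, hy0, hk, fun hm => lt_irrefl _ (hlt _ hm hy0),
      h.insert_of_lt hX hy0 hlt (fun hneg => absurd hx0 (hneg x hx).not_gt) ?_⟩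
    intro z hz hz0 hzmin
    exact ⟨k, by rw [le_antisymm (hzmin x hx hx0) (hmin z ⟨hz, hz0⟩)]⟩
  · obtain ⟨k, hk⟩ := hsmall ζp hζp
    push Not at hpos
    have hy0 : 0 < ζp * q ^ k := by positivity
    exact ⟨ζp * q ^ k, hy0, hk, fun hm => absurd hy0 (hpos _ hm).not_gt,
      h.insert_of_lt hX hy0 (fun z hz hz0 => absurd hz0 (hpos z hz).not_gt)
        (fun _ => ⟨k, by simp⟩) (fun z hz hz0 => absurd hz0 (hpos z hz).not_gt)⟩

/-- A finite configuration can be enlarged by any number of points arbitrarily close to `0`. -/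
lemma IsConfig.exists_enlarge (hq0 : 0 < q) (hq1 : q < 1) (ht0 : 0 < t) (ht1 : t < 1)
    (hζp : 0 < ζp) {X : Set ℝ} (h : IsConfig q t ζp ζm X) (hX : X.Finite) {ε : ℝ} (hε : 0 < ε)
    (k : ℕ) :
    ∃ Z, IsConfig q t ζp ζm Z ∧ Z.Finite ∧ Z.ncard = X.ncard + k ∧ X ⊆ Z ∧
      ∀ z ∈ Z, z ∈ X ∨ 0 < z ∧ z < ε := by
  induction k with
  | zero => exact ⟨X, h, hX, rfl, Subset.rfl, fun z hz => Or.inl hz⟩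
  | succ k ih =>
    obtain ⟨Z, hZ, hZf, hcard, hXZ, hnew⟩ := ih
    obtain ⟨y, hy0, hyε, hyZ, hins⟩ := hZ.exists_insert hq0 hq1 ht0 ht1 hζp hZf hε
    refine ⟨insert y Z, hins, hZf.insert y, ?_, hXZ.trans (subset_insert _ _), ?_⟩
    · rw [ncard_insert_of_notMem hyZ hZf, hcard, add_assoc]
    · rintro z (rfl | hz)
      · exact Or.inr ⟨hy0, hyε⟩
      · exact hnew z hz

/-- If `c` bounds all lattice points below `r`, then every positive point of a configuration
bounded by `r` lies in `c t^ℕ q^ℕ`. -/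
lemma IsConfig.exists_eq_mul_pow (hq0 : 0 < q) (hq1 : q < 1) (hζp : 0 < ζp) {X : Set ℝ}
    (h : IsConfig q t ζp ζm X) {r : ℝ} (hr : ∀ x ∈ X, x ≤ r) {m : ℤ} (hm : r ≤ ζp * q ^ m)
    {x : ℝ} (hx : x ∈ X) (hx0 : 0 < x) : ∃ i j : ℕ, x = ζp * q ^ m * t ^ i * q ^ j := by
  obtain ⟨-, -, h3, -, h5, -, h7, -⟩ := h
  induction hn : {y ∈ X | x < y}.ncard using Nat.strong_induction_on generalizing x with
  | _ n ih =>
    by_cases hmax : ∀ y ∈ X, 0 < y → y ≤ x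
    · obtain ⟨a, rfl⟩ := h5 x hx hx0 hmax
      have hle : q ^ a ≤ q ^ m := le_of_mul_le_mul_left ((hr _ hx).trans hm) hζp
      have hma : m ≤ a := (zpow_le_zpow_iff_right_of_lt_one₀ hq0 hq1).1 hle
      obtain ⟨j, rfl⟩ := Int.le.dest hma
      exact ⟨0, j, by rw [zpow_add₀ hq0.ne', zpow_natCast]; ring⟩
    · push Not at hmax
      obtain ⟨w, hw, -, hxw⟩ := hmax
      obtain ⟨y, ⟨hy, hxy⟩, hmin⟩ := Set.exists_min_image {y ∈ X | x < y} id
        (h3 x hx hx0) ⟨w, hw, hxw⟩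
      simp only [id] at hmin
      obtain ⟨k, hk⟩ := h7 y hy x hx hx0 hxy fun z hz =>
        (le_or_gt z x).imp_right fun hz' => hmin z ⟨hz, hz'⟩
      have hcard : {z ∈ X | y < z}.ncard < n := by
        rw [← hn]
        exact ncard_lt_ncard ⟨fun z hz => ⟨hz.1, hxy.trans hz.2⟩,
          fun hsub => lt_irrefl y (hsub ⟨hy, hxy⟩).2⟩ (h3 x hx hx0)
      obtain ⟨i, j, hij⟩ := ih _ hcard hy (hx0.trans hxy) rfl
      exact ⟨i + 1, j + k, by rw [hk, hij]; ring⟩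

/-- The positive points away from `0` of all configurations bounded by `r` form a finite set. -/
lemma exists_finite_forall_pos_mem (hq0 : 0 < q) (hq1 : q < 1) (ht0 : 0 < t) (ht1 : t < 1)
    (hζp : 0 < ζp) (ζm r : ℝ) {ε : ℝ} (hε : 0 < ε) :
    ∃ F : Set ℝ, F.Finite ∧ ∀ X, IsConfig q t ζp ζm X → (∀ x ∈ X, x ≤ r) →
      ∀ x ∈ X, ε ≤ x → x ∈ F := by
  obtain ⟨m, hm⟩ : ∃ m : ℤ, r ≤ ζp * q ^ m := by
    obtain ⟨n, hn⟩ := pow_unbounded_of_one_lt (r / ζp) ((one_lt_inv₀ hq0).2 hq1)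
    refine ⟨-n, ?_⟩
    rw [div_lt_iff₀' hζp] at hn
    simpa using hn.le
  set c := ζp * q ^ m with hc
  have hc0 : 0 < c := by positivity
  have hbound : ∀ a : ℝ, 0 < a → a < 1 → ∃ M : ℕ, ∀ i : ℕ, ε ≤ c * a ^ i → i < M := by
    intro a ha0 ha1
    obtain ⟨M, hM⟩ := exists_pow_lt_of_lt_one (div_pos hε hc0) ha1
    refine ⟨M, fun i hi => ?_⟩
    by_contra! hMi
    rw [lt_div_iff₀' hc0] at hM
    have := mul_le_mul_of_nonneg_left (pow_le_pow_of_le_one ha0.le ha1.le hMi) hc0.le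
    linarith
  obtain ⟨A, hA⟩ := hbound t ht0 ht1
  obtain ⟨B, hB⟩ := hbound q hq0 hq1
  refine ⟨(fun p : ℕ × ℕ => c * t ^ p.1 * q ^ p.2) '' (Iio A ×ˢ Iio B),
    ((finite_Iio A).prod (finite_Iio B)).image _, fun X hX hXr x hx hεx => ?_⟩
  obtain ⟨i, j, hij⟩ := hX.exists_eq_mul_pow hq0 hq1 hζp hXr hm hx (hε.trans_le hεx)
  rw [← hc] at hij
  refine ⟨(i, j), ⟨hA i ?_, hB j ?_⟩, hij.symm⟩
  · refine hεx.trans (hij.le.trans ?_)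
    exact mul_le_of_le_one_right (by positivity) (pow_le_one₀ hq0.le hq1.le)
  · refine hεx.trans (hij.le.trans ?_)
    rw [mul_right_comm]
    exact mul_le_of_le_one_right (by positivity) (pow_le_one₀ ht0.le ht1.le)

/-- The points away from `0` of all configurations in `[l, r]` form a finite set. -/
lemma exists_finite_forall_mem (hq0 : 0 < q) (hq1 : q < 1) (ht0 : 0 < t) (ht1 : t < 1)
    (hζp : 0 < ζp) (hζm : ζm < 0) (l r : ℝ) {ε : ℝ} (hε : 0 < ε) :
    ∃ F : Set ℝ, F.Finite ∧ ∀ X, IsConfig q t ζp ζm X → X ⊆ Icc l r →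
      ∀ x ∈ X, ε ≤ |x| → x ∈ F := by
  obtain ⟨F, hF, hFpos⟩ := exists_finite_forall_pos_mem hq0 hq1 ht0 ht1 hζp ζm r hε
  obtain ⟨G, hG, hGneg⟩ :=
    exists_finite_forall_pos_mem hq0 hq1 ht0 ht1 (neg_pos.2 hζm) (-ζp) (-l) hε
  refine ⟨F ∪ Neg.neg '' G, hF.union (hG.image _), fun X hX hXlr x hx hεx => ?_⟩
  rcases le_abs.1 hεx with h | h
  · exact Or.inl (hFpos X hX (fun z hz => (hXlr hz).2) x hx h)
  · refine Or.inr ⟨-x, hGneg (-X) hX.neg (fun z hz => ?_) (-x) (by simpa using hx) h, neg_neg x⟩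
    linarith [(hXlr hz).1]

/-- A set whose finite subsets all have at most `N` elements is finite with at most `N`
elements. -/
lemma Set.finite_and_ncard_le_of_forall_finset {α : Type*} {X : Set α} {N : ℕ}
    (h : ∀ s : Finset α, ↑s ⊆ X → s.card ≤ N) : X.Finite ∧ X.ncard ≤ N := by
  have hfin : X.Finite := by
    by_contra hinf
    obtain ⟨s, hs, hcard⟩ := Set.Infinite.exists_subset_card_eq hinf (N + 1)
    have := h s hs
    omega
  refine ⟨hfin, ?_⟩
  rw [ncard_eq_toFinset_card X hfin]
  exact h _ (by simp)

/-- A positive lower bound for the absolute values of a finite set of nonzero reals. -/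
lemma exists_pos_forall_le_abs {X : Set ℝ} (hX : X.Finite) (h0 : (0 : ℝ) ∉ X) :
    ∃ ε > 0, ∀ x ∈ X, ε ≤ |x| := by
  rcases X.eq_empty_or_nonempty with rfl | hne
  · exact ⟨1, one_pos, by simp⟩
  · obtain ⟨x, hx, hmin⟩ := Set.exists_min_image X (fun x => |x|) hX hne
    exact ⟨|x|, abs_pos.2 fun h => h0 (h ▸ hx), hmin⟩

/-- The configurations of at most `N` points in `[l, r]`. -/
def boundedConfigs (q t ζp ζm : ℝ) (N : ℕ) (l r : ℝ) : Set (OmegaTilde q t ζp ζm) :=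
  {X | X.1.Finite ∧ X.1.ncard ≤ N ∧ X.1 ⊆ Icc l r}

lemma isCompact_boundedConfigs (hq0 : 0 < q) (hq1 : q < 1) (ht0 : 0 < t) (ht1 : t < 1)
    (hζp : 0 < ζp) (hζm : ζm < 0) (N : ℕ) (l r : ℝ) :
    @IsCompact _ (cylTop q t ζp ζm) (boundedConfigs q t ζp ζm N l r) := by
  let _ := cylTop q t ζp ζm
  rw [isCompact_iff_ultrafilter_le_nhds']
  intro 𝓤 h𝓤
  set L : Set ℝ := {x | ∀ᶠ Z in (𝓤 : Filter (OmegaTilde q t ζp ζm)), x ∈ Z.1} with hL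
  have hconv : ∀ ε > 0, ∀ᶠ Z in (𝓤 : Filter (OmegaTilde q t ζp ζm)),
      ∀ x : ℝ, ε ≤ |x| → (x ∈ L ↔ x ∈ Z.1) := by
    intro ε hε
    obtain ⟨F, hF, hmem⟩ := exists_finite_forall_mem hq0 hq1 ht0 ht1 hζp hζm l r hε
    have hdec : ∀ᶠ Z in (𝓤 : Filter (OmegaTilde q t ζp ζm)), ∀ x ∈ F, (x ∈ L ↔ x ∈ Z.1) := by
      rw [eventually_all_finite hF]
      intro x _
      by_cases hx : x ∈ L
      · filter_upwards [show ∀ᶠ Z in (𝓤 : Filter (OmegaTilde q t ζp ζm)), x ∈ Z.1 from hx]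
          with Z hZ using iff_of_true hx hZ
      · filter_upwards [Ultrafilter.eventually_not.2 hx] with Z hZ using iff_of_false hx hZ
    filter_upwards [hdec, h𝓤] with Z hZ hZK x hεx
    by_cases hxF : x ∈ F
    · exact hZ x hxF
    · refine iff_of_false (fun hx => ?_) fun hx => hxF (hmem Z.1 Z.2 hZK.2.2 x hx hεx)
      obtain ⟨W, hW, hWK⟩ := (hx.and h𝓤).exists
      exact hxF (hmem W.1 W.2 hWK.2.2 x hW hεx)
  have hcard : L.Finite ∧ L.ncard ≤ N := by
    refine Set.finite_and_ncard_le_of_forall_finset fun s hs => ?_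
    have hsZ : ∀ᶠ Z in (𝓤 : Filter (OmegaTilde q t ζp ζm)), ∀ x ∈ s, x ∈ Z.1 :=
      (Filter.eventually_all_finset s).2 fun x hx => hs hx
    obtain ⟨Z, hZ, hZK⟩ := (hsZ.and h𝓤).exists
    rw [← ncard_coe_finset]
    exact (ncard_le_ncard hZ hZK.1).trans hZK.2.1
  have h0 : (0 : ℝ) ∉ L := fun h => by
    obtain ⟨Z, hZ⟩ := Filter.Eventually.exists h
    exact Z.2.2.1 hZ
  have hLlr : L ⊆ Icc l r := fun x hx => by
    obtain ⟨Z, hZ, hZK⟩ := (Filter.Eventually.and hx h𝓤).exists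
    exact hZK.2.2 hZ
  obtain ⟨ε, hε, hLε⟩ := exists_pos_forall_le_abs hcard.1 h0
  obtain ⟨Z, hZ⟩ := (hconv ε hε).exists
  refine ⟨⟨L, Z.2.of_agree hcard.1 hε hLε hZ⟩, ⟨hcard.1, hcard.2, hLlr⟩, ?_⟩
  exact (nhds_cylTop_hasBasis _).ge_iff.2 hconv

lemma closure_configs_eq_boundedConfigs (hq0 : 0 < q) (hq1 : q < 1) (ht0 : 0 < t) (ht1 : t < 1)
    (hζp : 0 < ζp) (N : ℕ) {l r : ℝ} (hl : l < 0) (hr : 0 < r) :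
    @closure _ (cylTop q t ζp ζm)
        {X : OmegaTilde q t ζp ζm | X.1.Finite ∧ X.1.ncard = N ∧ X.1 ⊆ Icc l r} =
      boundedConfigs q t ζp ζm N l r := by
  let _ := cylTop q t ζp ζm
  ext X
  rw [mem_closure_iff_nhds_basis (nhds_cylTop_hasBasis X)]
  constructor
  · intro hX
    have happrox : ∀ s : Finset ℝ, ↑s ⊆ X.1 → ∃ Z : OmegaTilde q t ζp ζm,
        (Z.1.Finite ∧ Z.1.ncard = N ∧ Z.1 ⊆ Icc l r) ∧ ↑s ⊆ Z.1 := by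
      intro s hs
      obtain ⟨ε, hε, hsε⟩ := exists_pos_forall_le_abs s.finite_toSet fun h => X.2.2.1 (hs h)
      obtain ⟨Z, hZ, hXZ⟩ := hX ε hε
      exact ⟨Z, hZ, fun x hx => (hXZ x (hsε x hx)).1 (hs hx)⟩
    obtain ⟨hfin, hcard⟩ := Set.finite_and_ncard_le_of_forall_finset (N := N) fun s hs => by
      obtain ⟨Z, ⟨hZf, hZN, -⟩, hsZ⟩ := happrox s hs
      rw [← ncard_coe_finset, ← hZN]
      exact ncard_le_ncard hsZ hZf
    refine ⟨hfin, hcard, fun x hx => ?_⟩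
    obtain ⟨Z, ⟨-, -, hZlr⟩, hsZ⟩ := happrox {x} (by simpa using hx)
    exact hZlr (hsZ (by simp))
  · rintro ⟨hfin, hcard, hlr⟩ ε hε
    obtain ⟨Z, hZ, hZf, hZN, hXZ, hnew⟩ := X.2.exists_enlarge hq0 hq1 ht0 ht1 hζp hfin
      (lt_min hε hr) (N - X.1.ncard)
    refine ⟨⟨Z, hZ⟩, ⟨hZf, hZN.trans (by omega), fun z hz => ?_⟩, fun x hεx =>
      ⟨fun hx => hXZ hx, fun hx => ?_⟩⟩
    · rcases hnew z hz with h | ⟨h0, h⟩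
      · exact hlr h
      · exact ⟨by linarith, h.le.trans (min_le_right _ _)⟩
    · rcases hnew x hx with h | ⟨h0, h⟩
      · exact h
      · rw [abs_of_pos h0] at hεx
        linarith [min_le_left ε r]

end Configurations

/-- The closure in `Ω̃` of `Ω_N[l,r]` (N-point configurations contained in `[l,r]`)
equals `Ω̃_N[l,r] = ⋃_{n=0}^N Ω_n[l,r]` (configurations of at most N points contained in
`[l,r]`), and the latter set is compact. -/
theorem stmt12 (q t ζp ζm : ℝ) (hq0 : 0 < q) (hq1 : q < 1) (ht0 : 0 < t) (ht1 : t < 1)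
    (hζp : 0 < ζp) (hζm : ζm < 0) (N : ℕ) (hN : 1 ≤ N)
    (l r : ℝ) (hl : l < 0) (hr : 0 < r) :
    @closure _ (cylTop q t ζp ζm)
        {X : OmegaTilde q t ζp ζm | X.1.Finite ∧ X.1.ncard = N ∧ X.1 ⊆ Set.Icc l r} =
      {X : OmegaTilde q t ζp ζm | X.1.Finite ∧ X.1.ncard ≤ N ∧ X.1 ⊆ Set.Icc l r} ∧
    @IsCompact _ (cylTop q t ζp ζm)
      {X : OmegaTilde q t ζp ζm | X.1.Finite ∧ X.1.ncard ≤ N ∧ X.1 ⊆ Set.Icc l r} := by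
  exact ⟨closure_configs_eq_boundedConfigs hq0 hq1 ht0 ht1 hζp N hl hr,
    isCompact_boundedConfigs hq0 hq1 ht0 ht1 hζp hζm N l r⟩
end
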